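/- Let X be a nonempty set and let Φ be a mapping with domain X². The following statements are equivalent: (1) there is a strongly rigid Ptolemaic pseudometric d on X such that Φ is combinatorially similar to d; (2) there is a strongly rigid pseudometric d on X such that Φ is combinatorially similar to d; (3) Φ is symmetric (Φ(x,y) = Φ(y,x) for all x,y ∈ X), |Φ(X²)| ≤ 𝔠 holds, where 𝔠 is the cardinality of the continuum, there is a₀ ∈ Φ(X²) such that Φ is a₀-coherent, and, for all x, y, u, v ∈ X, the condition Φ(x,y) = Φ(u,v) ≠ a₀ implies (x ≎_{a₀} u and y ≎_{a₀} v) or (x ≎_{a₀} v and y ≎_{a₀} u). -/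

import Mathlib

open Set

universe u v w z

def range2 {X : Type u} {A : Type w} (Φ : X → X → A) : Set A := {a | ∃ x y, Φ x y = a}

def fiber {X : Type u} {A : Type w} (Φ : X → X → A) (a : A) : Set (X × X) :=
  {p | Φ p.1 p.2 = a}

def fibers {X : Type u} {A : Type w} (Φ : X → X → A) : Set (Set (X × X)) :=
  {R | ∃ a ∈ range2 Φ, R = fiber Φ a}

def IsCoherent {X : Type u} {A : Type w} (Φ : X → X → A) (a₀ : A) : Prop :=
  Equivalence (fun x y => Φ x y = a₀) ∧
    ∀ x₁ x₂ x₃ x₄, Φ x₁ x₂ = a₀ → Φ x₃ x₄ = a₀ → Φ x₁ x₃ = Φ x₂ x₄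

def CombSim {X : Type u} {Y : Type v} {A : Type w} {B : Type z}
    (Φ : X → X → A) (Ψ : Y → Y → B) : Prop :=
  ∃ (g : Y → X) (f : A → B), Function.Bijective g ∧
    Set.BijOn f (range2 Φ) (range2 Ψ) ∧ ∀ x y, Ψ x y = f (Φ (g x) (g y))

def IsPseudometric {X : Type u} (d : X → X → ℝ) : Prop :=
  (∀ x y, 0 ≤ d x y) ∧ (∀ x y, d x y = d y x) ∧ (∀ x, d x x = 0) ∧
    ∀ x y z, d x y ≤ d x z + d z y

def IsPtolemaic {X : Type u} (d : X → X → ℝ) : Prop :=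
  ∀ x y zz t, d x y * d zz t ≤ d x zz * d y t + d x t * d y zz

def IsStronglyRigid {X : Type u} (d : X → X → ℝ) : Prop :=
  ∀ x y uu vv, d x y = d uu vv → d x y ≠ 0 →
    (d x uu = 0 ∧ d y vv = 0) ∨ (d x vv = 0 ∧ d y uu = 0)

theorem IsPseudometric.eq_of_eq_zero {X : Type u} {d : X → X → ℝ} (hd : IsPseudometric d)
    {x₁ x₂ x₃ x₄ : X} (h₁₂ : d x₁ x₂ = 0) (h₃₄ : d x₃ x₄ = 0) : d x₁ x₃ = d x₂ x₄ := by
  obtain ⟨-, hsymm, -, htri⟩ := hd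
  linarith [htri x₁ x₃ x₂, htri x₂ x₃ x₄, htri x₂ x₄ x₁, htri x₁ x₄ x₃, hsymm x₁ x₂,
    hsymm x₃ x₄]

theorem IsPseudometric.isCoherent {X : Type u} {d : X → X → ℝ} (hd : IsPseudometric d) :
    IsCoherent d 0 := by
  refine ⟨⟨hd.2.2.1, fun {x y} h => (hd.2.1 y x).trans h, fun {x y z} h h' => ?_⟩,
    fun _ _ _ _ => hd.eq_of_eq_zero⟩
  exact (hd.eq_of_eq_zero h (hd.2.2.1 z)).trans h'

theorem isPseudometric_of_eq_zero_or_mem_Icc {X : Type u} {d : X → X → ℝ}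
    (hsymm : ∀ x y, d x y = d y x) (hself : ∀ x, d x x = 0)
    (hval : ∀ x y, d x y = 0 ∨ d x y ∈ Icc (1 : ℝ) (6 / 5))
    (hcoh : ∀ x y z, d x y = 0 → d x z = d y z) : IsPseudometric d := by
  have hnonneg : ∀ x y, 0 ≤ d x y := fun x y => by
    rcases hval x y with h | h
    · exact h.ge
    · linarith [h.1]
  refine ⟨hnonneg, hsymm, hself, fun x y z => ?_⟩
  rcases hval x z with h | h
  · rw [h, hcoh x z y h, zero_add]
  rcases hval z y with h' | h'
  · rw [h', hsymm x y, hsymm x z, hcoh z y x h', add_zero]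
  rcases hval x y with h'' | h''
  · rw [h'']
    linarith [h.1, h'.1]
  · linarith [h.1, h'.1, h''.2]

theorem isPtolemaic_of_eq_zero_or_mem_Icc {X : Type u} {d : X → X → ℝ}
    (hsymm : ∀ x y, d x y = d y x)
    (hval : ∀ x y, d x y = 0 ∨ d x y ∈ Icc (1 : ℝ) (6 / 5))
    (hcoh : ∀ x y z, d x y = 0 → d x z = d y z) : IsPtolemaic d := by
  have hnonneg : ∀ x y, 0 ≤ d x y := fun x y => by
    rcases hval x y with h | h
    · exact h.ge
    · linarith [h.1]
  have hle : ∀ x y, d x y ≤ 6 / 5 := fun x y => by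
    rcases hval x y with h | h
    · rw [h]
      norm_num
    · exact h.2
  intro x y z t
  rcases hval x z with hxz | hxz
  · rw [hcoh x z y hxz, hcoh x z t hxz, hxz, hsymm z y]
    linarith
  rcases hval y t with hyt | hyt
  · rw [hsymm x y, hcoh y t x hyt, hcoh y t z hyt, hyt, hsymm t x, hsymm t z]
    linarith
  rcases hval x t with hxt | hxt
  · rw [hcoh x t y hxt, hcoh x t z hxt, hxt, hsymm t y, hsymm t z]
    linarith
  rcases hval y z with hyz | hyz
  · rw [hsymm x y, hcoh y z x hyz, hcoh y z t hyz, hyz, hsymm z x]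
    linarith
  have h₁ := mul_le_mul (hle x y) (hle z t) (hnonneg z t) (by norm_num)
  have h₂ := one_le_mul_of_one_le_of_one_le hxz.1 hyt.1
  have h₃ := one_le_mul_of_one_le_of_one_le hxt.1 hyz.1
  linarith

theorem exists_injOn_of_mk_le_continuum {A : Type w} {s : Set A}
    (hs : Cardinal.mk s ≤ Cardinal.continuum) (a₀ : A) :
    ∃ f : A → ℝ, InjOn f s ∧ f a₀ = 0 ∧ ∀ a ∈ s, a ≠ a₀ → f a ∈ Icc (1 : ℝ) (6 / 5) := by
  classical
  have hcard : Cardinal.lift.{0} (Cardinal.mk s) ≤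
      Cardinal.lift.{w} (Cardinal.mk (Icc (1 : ℝ) (6 / 5))) := by
    rw [Cardinal.mk_Icc_real (by norm_num), Cardinal.lift_continuum, Cardinal.lift_uzero]
    exact hs
  obtain ⟨e⟩ := Cardinal.lift_mk_le'.1 hcard
  let f : A → ℝ := fun a => if a = a₀ then 0 else if h : a ∈ s then e ⟨a, h⟩ else 0
  have hf₀ : f a₀ = 0 := if_pos rfl
  have hf : ∀ (a) (h : a ∈ s), a ≠ a₀ → f a = e ⟨a, h⟩ := fun a h hne => by
    simp only [f, if_neg hne, dif_pos h]
  have hmem : ∀ a ∈ s, a ≠ a₀ → f a ∈ Icc (1 : ℝ) (6 / 5) := fun a h hne => by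
    rw [hf a h hne]
    exact (e ⟨a, h⟩).2
  refine ⟨f, fun a ha b hb hab => ?_, hf₀, hmem⟩
  by_cases h : a = a₀ <;> by_cases h' : b = a₀
  · rw [h, h']
  · have := (hmem b hb h').1
    rw [← hab, h, hf₀] at this
    norm_num at this
  · have := (hmem a ha h).1
    rw [hab, h', hf₀] at this
    norm_num at this
  · rw [hf a ha h, hf b hb h'] at hab
    exact congrArg Subtype.val (e.injective (Subtype.ext hab))

theorem mem_range2 {X : Type u} {A : Type w} (Φ : X → X → A) (x y : X) : Φ x y ∈ range2 Φ :=
  ⟨x, y, rfl⟩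

/-- The characterization of mappings combinatorially similar to strongly rigid pseudometrics. -/
def IsRigidCoherent {X : Type u} {A : Type w} (Φ : X → X → A) : Prop :=
  (∀ x y, Φ x y = Φ y x) ∧ Cardinal.mk (range2 Φ) ≤ Cardinal.continuum ∧
    ∃ a₀ ∈ range2 Φ, IsCoherent Φ a₀ ∧
      ∀ x y uu vv, Φ x y = Φ uu vv → Φ x y ≠ a₀ →
        (Φ x uu = a₀ ∧ Φ y vv = a₀) ∨ (Φ x vv = a₀ ∧ Φ y uu = a₀)

theorem IsRigidCoherent.exists_combSim {X : Type u} {A : Type w} {Φ : X → X → A}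
    (h : IsRigidCoherent Φ) :
    ∃ d : X → X → ℝ, IsPseudometric d ∧ IsStronglyRigid d ∧ IsPtolemaic d ∧ CombSim Φ d := by
  obtain ⟨hsymm, hcard, a₀, ha₀, ⟨heqv, hcoh⟩, hrigid⟩ := h
  obtain ⟨f, hinj, hf₀, hf⟩ := exists_injOn_of_mk_le_continuum hcard a₀
  have hzero : ∀ x y, f (Φ x y) = 0 ↔ Φ x y = a₀ := fun x y => by
    rw [← hf₀]
    exact hinj.eq_iff (mem_range2 Φ x y) ha₀
  have hsymm' : ∀ x y, f (Φ x y) = f (Φ y x) := fun x y => congrArg f (hsymm x y)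
  have hval : ∀ x y, f (Φ x y) = 0 ∨ f (Φ x y) ∈ Icc (1 : ℝ) (6 / 5) := fun x y =>
    (eq_or_ne (Φ x y) a₀).imp (hzero x y).2 (hf _ (mem_range2 Φ x y))
  have hcoh' : ∀ x y z, f (Φ x y) = 0 → f (Φ x z) = f (Φ y z) := fun x y z hxy =>
    congrArg f (hcoh x y z z ((hzero x y).1 hxy) (heqv.refl z))
  refine ⟨fun x y => f (Φ x y),
    isPseudometric_of_eq_zero_or_mem_Icc hsymm' (fun x => (hzero x x).2 (heqv.refl x)) hval hcoh',
    fun x y u v hxy hne => ?_, isPtolemaic_of_eq_zero_or_mem_Icc hsymm' hval hcoh',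
    id, f, Function.bijective_id, ⟨?_, hinj, ?_⟩, fun _ _ => rfl⟩
  · simp only [hzero]
    exact hrigid x y u v (hinj (mem_range2 Φ x y) (mem_range2 Φ u v) hxy)
      fun h => hne ((hzero x y).2 h)
  · rintro _ ⟨x, y, rfl⟩
    exact ⟨x, y, rfl⟩
  · rintro _ ⟨x, y, rfl⟩
    exact ⟨Φ x y, mem_range2 Φ x y, rfl⟩

theorem CombSim.isRigidCoherent {X : Type u} {Y : Type v} {A : Type w} [Nonempty X]
    {Φ : X → X → A} {d : Y → Y → ℝ} (hd : IsPseudometric d) (hrigid : IsStronglyRigid d)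
    (h : CombSim Φ d) : IsRigidCoherent Φ := by
  obtain ⟨g, f, hg, hf, hfd⟩ := h
  have hinj : ∀ {x y u v}, f (Φ x y) = f (Φ u v) → Φ x y = Φ u v := fun {x y u v} h =>
    hf.injOn (mem_range2 Φ x y) (mem_range2 Φ u v) h
  obtain ⟨y₀, -⟩ := hg.surjective (Classical.arbitrary X)
  have hzero : ∀ x y, Φ (g x) (g y) = Φ (g y₀) (g y₀) ↔ d x y = 0 := fun x y => by
    rw [← hd.2.2.1 y₀, hfd, hfd]
    exact ⟨congrArg f, hinj⟩
  have hcoh := hd.isCoherent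
  refine ⟨?_, ?_, Φ (g y₀) (g y₀), mem_range2 Φ _ _, ⟨⟨?_, ?_, ?_⟩, ?_⟩, ?_⟩
  · refine hg.surjective.forall₂.2 fun x y => hinj ?_
    rw [← hfd, ← hfd, hd.2.1]
  · have hle := Cardinal.lift_mk_le'.2
      ⟨(⟨fun a : range2 Φ => f a, hf.injOn.injective⟩ : range2 Φ ↪ ℝ)⟩
    rwa [Cardinal.mk_real, Cardinal.lift_continuum, Cardinal.lift_uzero] at hle
  · refine hg.surjective.forall.2 fun x => ?_
    exact (hzero x x).2 (hcoh.1.refl x)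
  · intro x y
    obtain ⟨x, rfl⟩ := hg.surjective x
    obtain ⟨y, rfl⟩ := hg.surjective y
    simp only [hzero]
    exact hcoh.1.symm
  · intro x y z
    obtain ⟨x, rfl⟩ := hg.surjective x
    obtain ⟨y, rfl⟩ := hg.surjective y
    obtain ⟨z, rfl⟩ := hg.surjective z
    simp only [hzero]
    exact hcoh.1.trans
  · refine hg.surjective.forall₂.2 fun x₁ x₂ => hg.surjective.forall₂.2 fun x₃ x₄ => ?_
    simp only [hzero]
    intro h₁₂ h₃₄
    apply hinj
    rw [← hfd, ← hfd]
    exact hcoh.2 x₁ x₂ x₃ x₄ h₁₂ h₃₄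
  · refine hg.surjective.forall₂.2 fun x y => hg.surjective.forall₂.2 fun u v => ?_
    simp only [ne_eq, hzero]
    intro h
    apply hrigid
    rw [hfd, hfd, h]

/-- Proposition 4.4: for a mapping `Φ` with domain `X²` the following are equivalent:
(1) `Φ` is combinatorially similar to a strongly rigid Ptolemaic pseudometric on `X`;
(2) `Φ` is combinatorially similar to a strongly rigid pseudometric on `X`;
(3) `Φ` is symmetric, `|Φ(X²)| ≤ 𝔠`, `Φ` is `a₀`-coherent for some `a₀ ∈ Φ(X²)`, and
`Φ(x,y) = Φ(u,v) ≠ a₀` implies `(x ≎ u ∧ y ≎ v) ∨ (x ≎ v ∧ y ≎ u)`. -/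
theorem combSim_stronglyRigid_pseudometric_tfae {X : Type u} {A : Type w} [Nonempty X]
    (Φ : X → X → A) :
    ((∃ d : X → X → ℝ, IsPseudometric d ∧ IsStronglyRigid d ∧ IsPtolemaic d ∧
        CombSim Φ d) ↔
      (∃ d : X → X → ℝ, IsPseudometric d ∧ IsStronglyRigid d ∧ CombSim Φ d)) ∧
    ((∃ d : X → X → ℝ, IsPseudometric d ∧ IsStronglyRigid d ∧ CombSim Φ d) ↔
      ((∀ x y, Φ x y = Φ y x) ∧ Cardinal.mk (range2 Φ) ≤ Cardinal.continuum ∧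
        ∃ a₀ ∈ range2 Φ, IsCoherent Φ a₀ ∧
          ∀ x y uu vv, Φ x y = Φ uu vv → Φ x y ≠ a₀ →
            (Φ x uu = a₀ ∧ Φ y vv = a₀) ∨ (Φ x vv = a₀ ∧ Φ y uu = a₀))) := by
  refine ⟨⟨fun ⟨d, hd, hr, _, hs⟩ => ⟨d, hd, hr, hs⟩, fun ⟨d, hd, hr, hs⟩ =>
    (hs.isRigidCoherent hd hr).exists_combSim⟩, fun ⟨d, hd, hr, hs⟩ => hs.isRigidCoherent hd hr,
    fun h => ?_⟩
  obtain ⟨d, hd, hr, -, hs⟩ := IsRigidCoherent.exists_combSim h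
  exact ⟨d, hd, hr, hs⟩
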